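/- Let 𝒰 = U((1,0),(0,1), v_1, …, v_n) be a non-degenerate (n+2, 2)-Ulam set such that none of the vectors v_1, …, v_n lies on a coordinate axis (i.e., each v_i has both coordinates ≥ 1). Then there exists (w_1, w_2) ∈ ℤ_{≥0}² such that for every (m, n') ∈ 𝒰 with m ≥ w_1 and n' ≥ w_2, one has m ≡ w_1 (mod 2) and n' ≡ w_2 (mod 2). -/

import Mathlib

/-- The norm `|(x,y)| = x + y` on `ℤ_{≥0}²`. -/
def vnorm (v : ℕ × ℕ) : ℕ := v.1 + v.2

/-- `v` has a representation as a sum of two distinct elements of `S`. -/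
def HasRep (S : Set (ℕ × ℕ)) (v : ℕ × ℕ) : Prop :=
  ∃ a b : ℕ × ℕ, a ∈ S ∧ b ∈ S ∧ a ≠ b ∧ a + b = v

/-- `v` can be written as a sum of two distinct elements of `S` in exactly one way
(as an unordered pair). -/
def UniqueRep (S : Set (ℕ × ℕ)) (v : ℕ × ℕ) : Prop :=
  ∃ a b : ℕ × ℕ, a ∈ S ∧ b ∈ S ∧ a ≠ b ∧ a + b = v ∧
    ∀ c d : ℕ × ℕ, c ∈ S → d ∈ S → c ≠ d → c + d = v →
      (c = a ∧ d = b) ∨ (c = b ∧ d = a)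

/-- One step of the Ulam process: adjoin all new vectors of minimal norm among those
having exactly one representation as a sum of two distinct elements of `S`. -/
def ulamStep (S : Set (ℕ × ℕ)) : Set (ℕ × ℕ) :=
  S ∪ {v | v ∉ S ∧ UniqueRep S v ∧
    ∀ w : ℕ × ℕ, w ∉ S → UniqueRep S w → vnorm v ≤ vnorm w}

/-- The stages of the Ulam process started from the set `init`. -/
def ulamStage (init : Set (ℕ × ℕ)) : ℕ → Set (ℕ × ℕ)
  | 0 => init
  | j + 1 => ulamStep (ulamStage init j)

/-- The Ulam set generated by the initial vectors `init`. -/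
def ulamSet2 (init : Set (ℕ × ℕ)) : Set (ℕ × ℕ) := ⋃ j, ulamStage init j

/-- Non-degeneracy: no initial vector belongs to the Ulam set generated by the
remaining initial vectors. -/
def NonDegenerate (l : List (ℕ × ℕ)) : Prop :=
  ∀ i : Fin l.length, l.get i ∉ ulamSet2 {w | ∃ j : Fin l.length, j ≠ i ∧ l.get j = w}

/-- The region `W_{(v₁,v₂)}`. -/
def W (v : ℕ × ℕ) : Set (ℕ × ℕ) := {p | p.1 < v.1 ∨ p.2 < v.2}

theorem UniqueRep.eq_or_eq {S : Set (ℕ × ℕ)} {v a b c d : ℕ × ℕ} (h : UniqueRep S v)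
    (ha : a ∈ S) (hb : b ∈ S) (hab : a ≠ b) (hv : a + b = v)
    (hc : c ∈ S) (hd : d ∈ S) (hcd : c ≠ d) (hv' : c + d = v) : c = a ∨ c = b := by
  obtain ⟨p, q, -, -, -, -, h⟩ := h
  rcases h a b ha hb hab hv with ⟨rfl, rfl⟩ | ⟨rfl, rfl⟩ <;>
    rcases h c d hc hd hcd hv' with ⟨rfl, rfl⟩ | ⟨rfl, rfl⟩ <;> simp

theorem vnorm_add (a b : ℕ × ℕ) : vnorm (a + b) = vnorm a + vnorm b := by
  simp only [vnorm, Prod.fst_add, Prod.snd_add]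
  omega

/-- Having a unique representation depends only on the elements of smaller norm. -/
theorem uniqueRep_congr {S T : Set (ℕ × ℕ)} {w : ℕ × ℕ} (hST : S ⊆ T)
    (hpos : ∀ u ∈ T, 0 < vnorm u) (h : ∀ u ∈ T, vnorm u < vnorm w → u ∈ S) :
    UniqueRep T w ↔ UniqueRep S w := by
  have key : ∀ a b, a ∈ T → b ∈ T → a + b = w → a ∈ S ∧ b ∈ S := by
    intro a b ha hb hab
    have hn := vnorm_add a b
    rw [hab] at hn
    have := hpos a ha
    have := hpos b hb
    exact ⟨h a ha (by omega), h b hb (by omega)⟩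
  constructor
  · rintro ⟨a, b, ha, hb, hab, hw, hu⟩
    obtain ⟨ha', hb'⟩ := key a b ha hb hw
    exact ⟨a, b, ha', hb', hab, hw, fun c d hc hd => hu c d (hST hc) (hST hd)⟩
  · rintro ⟨a, b, ha, hb, hab, hw, hu⟩
    refine ⟨a, b, hST ha, hST hb, hab, hw, fun c d hc hd hcd hw' => ?_⟩
    obtain ⟨hc', hd'⟩ := key c d hc hd hw'
    exact hu c d hc' hd' hcd hw'

theorem UniqueRep.preimage_swap {S : Set (ℕ × ℕ)} {v : ℕ × ℕ} (h : UniqueRep S v) :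
    UniqueRep (Prod.swap ⁻¹' S) v.swap := by
  obtain ⟨a, b, ha, hb, hab, rfl, hu⟩ := h
  refine ⟨a.swap, b.swap, by simpa using ha, by simpa using hb,
    fun h => hab (Prod.swap_injective h), rfl, fun c d hc hd hcd hw => ?_⟩
  rcases hu c.swap d.swap hc hd (fun h => hcd (Prod.swap_injective h))
    (by simpa using congrArg Prod.swap hw) with
    ⟨rfl, rfl⟩ | ⟨rfl, rfl⟩ <;> simp

theorem ulamStage_mono (I : Set (ℕ × ℕ)) : Monotone (ulamStage I) :=
  monotone_nat_of_le_succ fun _ => Set.subset_union_left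

/-- The only elements on the coordinate axes are `(0, 1)` and `(1, 0)`. -/
def AxesTrivial (S : Set (ℕ × ℕ)) : Prop :=
  ∀ u ∈ S, (u.1 = 0 → u = (0, 1)) ∧ (u.2 = 0 → u = (1, 0))

theorem AxesTrivial.vnorm_pos {S : Set (ℕ × ℕ)} (h : AxesTrivial S) {u : ℕ × ℕ} (hu : u ∈ S) :
    0 < vnorm u := by
  rcases Nat.eq_zero_or_pos u.1 with h0 | h0
  · rw [(h u hu).1 h0]
    decide
  · unfold vnorm
    omega

theorem axesTrivial_ulamStage {I : Set (ℕ × ℕ)} (hI : AxesTrivial I) (j : ℕ) :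
    AxesTrivial (ulamStage I j) := by
  induction j with
  | zero => exact hI
  | succ j ih =>
    rintro u (hu | ⟨-, ⟨a, b, ha, hb, hab, rfl, -⟩, -⟩)
    · exact ih u hu
    · simp only [Prod.fst_add, Prod.snd_add, Nat.add_eq_zero_iff]
      exact ⟨fun h => absurd (((ih a ha).1 h.1).trans ((ih b hb).1 h.2).symm) hab,
        fun h => absurd (((ih a ha).2 h.1).trans ((ih b hb).2 h.2).symm) hab⟩

theorem axesTrivial_ulamSet2 {I : Set (ℕ × ℕ)} (hI : AxesTrivial I) :
    AxesTrivial (ulamSet2 I) := by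
  intro u hu
  obtain ⟨j, hj⟩ := Set.mem_iUnion.1 hu
  exact axesTrivial_ulamStage hI j u hj

/-- The candidates for adjunction at a later stage have larger norm. -/
theorem candidate_norm_succ {I : Set (ℕ × ℕ)} (hI : AxesTrivial I) {j m : ℕ}
    (h : ∀ w, w ∉ ulamStage I j → UniqueRep (ulamStage I j) w → m ≤ vnorm w) :
    ∀ w, w ∉ ulamStage I (j + 1) → UniqueRep (ulamStage I (j + 1)) w → m + 1 ≤ vnorm w := by
  intro w hw hrep
  by_contra! hlt
  have hrep' : UniqueRep (ulamStage I j) w := by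
    refine (uniqueRep_congr (ulamStage_mono I (Nat.le_succ j))
      (fun u hu => (axesTrivial_ulamStage hI _).vnorm_pos hu) ?_).1 hrep
    rintro u (hu | ⟨hu, hr, -⟩) hn
    · exact hu
    · have := h u hu hr
      omega
  have hw' : w ∉ ulamStage I j := fun h' => hw (ulamStage_mono I (Nat.le_succ j) h')
  refine hw (Or.inr ⟨hw', hrep', fun z hz hzr => ?_⟩)
  have := h z hz hzr
  omega

theorem candidate_norm_add {I : Set (ℕ × ℕ)} (hI : AxesTrivial I) {j m : ℕ}
    (h : ∀ w, w ∉ ulamStage I j → UniqueRep (ulamStage I j) w → m ≤ vnorm w) (k : ℕ) :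
    ∀ w, w ∉ ulamStage I (j + k) → UniqueRep (ulamStage I (j + k)) w → m + k ≤ vnorm w := by
  induction k with
  | zero => exact h
  | succ k ih => exact candidate_norm_succ hI ih

theorem mem_or_uniqueRep_of_mem_ulamSet2 {I : Set (ℕ × ℕ)} (hI : AxesTrivial I) {u : ℕ × ℕ}
    (hu : u ∈ ulamSet2 I) : u ∈ I ∨ UniqueRep (ulamSet2 I) u := by
  obtain ⟨j, hj⟩ := Set.mem_iUnion.1 hu
  induction j with
  | zero => exact Or.inl hj
  | succ j ih =>
    rcases hj with hj | ⟨hj, hr, hmin⟩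
    · exact ih hj
    right
    refine (uniqueRep_congr (Set.subset_iUnion _ j)
      (fun u hu => (axesTrivial_ulamSet2 hI).vnorm_pos hu) ?_).2 hr
    have later : ∀ k, ∀ z ∈ ulamStage I (j + k), vnorm z < vnorm u → z ∈ ulamStage I j := by
      intro k
      induction k with
      | zero => exact fun z hz _ => hz
      | succ k ihk =>
        rintro z (hz | ⟨hz, hzr, -⟩) hn
        · exact ihk z hz hn
        · have := candidate_norm_add hI hmin k z hz hzr
          omega
    intro z hz hn
    obtain ⟨k, hk⟩ := Set.mem_iUnion.1 hz
    exact later k z (ulamStage_mono I (Nat.le_add_left k j) hk) hn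

theorem mem_ulamSet2_of_uniqueRep {I : Set (ℕ × ℕ)} (hI : AxesTrivial I) {u : ℕ × ℕ}
    (hu : UniqueRep (ulamSet2 I) u) : u ∈ ulamSet2 I := by
  by_contra hn
  obtain ⟨a, b, ha, hb, hab, hw, huniq⟩ := hu
  obtain ⟨i, hi⟩ := Set.mem_iUnion.1 ha
  obtain ⟨j, hj⟩ := Set.mem_iUnion.1 hb
  have hle : ∀ k, ulamStage I k ⊆ ulamSet2 I := Set.subset_iUnion _
  have hrep : UniqueRep (ulamStage I (0 + (i + j + vnorm u + 1))) u :=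
    ⟨a, b, ulamStage_mono I (by omega) hi, ulamStage_mono I (by omega) hj, hab, hw,
      fun c d hc hd => huniq c d (hle _ hc) (hle _ hd)⟩
  have := candidate_norm_add hI (j := 0) (m := 0) (fun _ _ _ => Nat.zero_le _) _ u
    (fun h => hn (hle _ h)) hrep
  omega

/-- The properties of an Ulam set containing `(1, 0)` and `(0, 1)` whose other initial vectors
lie off the axes and have coordinates less than `M`. -/
structure PlanarUlam (U : Set (ℕ × ℕ)) (M : ℕ) : Prop where
  one_zero : (1, 0) ∈ U
  zero_one : (0, 1) ∈ U
  axes : AxesTrivial U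
  uniqueRep : ∀ u ∈ U, M ≤ u.1 ∨ M ≤ u.2 → UniqueRep U u
  mem : ∀ u, UniqueRep U u → u ∈ U

namespace PlanarUlam

variable {U : Set (ℕ × ℕ)} {M : ℕ}

theorem swap (h : PlanarUlam U M) : PlanarUlam (Prod.swap ⁻¹' U) M where
  one_zero := h.zero_one
  zero_one := h.one_zero
  axes u hu := by
    obtain ⟨h1, h2⟩ := h.axes _ hu
    exact ⟨fun h0 => Prod.swap_injective (h2 h0), fun h0 => Prod.swap_injective (h1 h0)⟩
  uniqueRep u hu hM := UniqueRep.preimage_swap (h.uniqueRep _ hu hM.symm)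
  mem u hu := h.mem _ (UniqueRep.preimage_swap hu)

theorem one_mem (h : PlanarUlam U M) (y : ℕ) : (1, y) ∈ U := by
  induction y with
  | zero => exact h.one_zero
  | succ y ih =>
    refine h.mem _ ⟨(0, 1), (1, y), h.zero_one, ih, by simp, by simp [add_comm], ?_⟩
    rintro ⟨c1, c2⟩ ⟨d1, d2⟩ hc hd - hcd
    have hc0 := (h.axes _ hc).1
    have hd0 := (h.axes _ hd).1
    simp only [Prod.mk_add_mk, Prod.mk.injEq] at hcd hc0 hd0 ⊢
    omega

theorem mem_one (h : PlanarUlam U M) (x : ℕ) : (x, 1) ∈ U :=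
  h.swap.one_mem x

/-- An element at height at least `2` in column `x` excludes everything further up in
column `x + 1`. -/
theorem not_mem_succ_column (h : PlanarUlam U M) {x k y : ℕ} (hx : 2 ≤ x) (hk : 2 ≤ k)
    (hky : k ≤ y) (hM : M ≤ x + 1 ∨ M ≤ y) (hmem : (x, k) ∈ U) : (x + 1, y) ∉ U := by
  intro hxy
  have := (h.uniqueRep _ hxy hM).eq_or_eq (h.one_mem (y - 1)) (h.mem_one x)
    (by simp only [ne_eq, Prod.mk.injEq]; omega)
    (by simp only [Prod.mk_add_mk, Prod.mk.injEq]; omega)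
    (h.one_mem (y - k)) hmem
    (by simp only [ne_eq, Prod.mk.injEq]; omega)
    (by simp only [Prod.mk_add_mk, Prod.mk.injEq]; omega)
  simp only [Prod.mk.injEq] at this
  omega

/-- An element in column at least `2` of row `y` excludes everything further right in
row `y + 1`. -/
theorem not_mem_succ_row (h : PlanarUlam U M) {x k y : ℕ} (hy : 2 ≤ y) (hk : 2 ≤ k)
    (hkx : k ≤ x) (hM : M ≤ x ∨ M ≤ y + 1) (hmem : (k, y) ∈ U) : (x, y + 1) ∉ U :=
  h.swap.not_mem_succ_column hy hk hkx hM.symm hmem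

theorem not_mem_column_two (h : PlanarUlam U M) {y : ℕ} (hy : 3 ≤ y) (hM : M ≤ y) :
    (2, y) ∉ U := by
  intro hxy
  have := (h.uniqueRep _ hxy (Or.inr hM)).eq_or_eq (h.one_mem 0) (h.one_mem y)
    (by simp only [ne_eq, Prod.mk.injEq]; omega)
    (by simp)
    (h.one_mem 1) (h.one_mem (y - 1))
    (by simp only [ne_eq, Prod.mk.injEq]; omega)
    (by rw [Prod.mk_add_mk, Nat.add_sub_cancel' (by omega)])
  simp only [Prod.mk.injEq] at this
  omega

/-- Some column contains no element of height at least `2`. -/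
theorem exists_empty_column (h : PlanarUlam U M) : ∃ c, 2 ≤ c ∧ ∀ y, 2 ≤ y → (c, y) ∉ U := by
  by_contra! hne
  have descent : ∀ y x, 2 ≤ x → M ≤ x → 2 ≤ y → (x, y) ∉ U := by
    intro y
    induction y using Nat.strong_induction_on with
    | _ y ih =>
      intro x hx hM hy hxy
      obtain ⟨k, hk, hmem⟩ := hne (x + 1) (by omega)
      by_cases hlt : k < y
      · exact ih k hlt (x + 1) (by omega) (by omega) hk hmem
      · exact h.not_mem_succ_column hx hy (by omega) (by omega) hxy hmem
  obtain ⟨y, hy, hmem⟩ := hne (M + 2) (by omega)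
  exact descent y (M + 2) (by omega) (by omega) hy hmem

theorem exists_column_bound (h : PlanarUlam U M) {c : ℕ}
    (hne : ∀ x, 2 ≤ x → x < c → ∃ y, 2 ≤ y ∧ (x, y) ∈ U) :
    ∃ B, ∀ x y, 2 ≤ x → x ≤ c → (x, y) ∈ U → y < B := by
  have bound : ∀ x, ∃ B, 2 ≤ x → x ≤ c → ∀ y, (x, y) ∈ U → y < B := by
    intro x
    by_cases hx : x ≤ 2
    · refine ⟨M + 3, fun h2 _ y hy => ?_⟩
      by_contra! hlt
      obtain rfl : x = 2 := by omega
      exact h.not_mem_column_two (by omega) (by omega) hy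
    · by_cases hxc : x ≤ c
      · obtain ⟨k, hk, hmem⟩ := hne (x - 1) (by omega) (by omega)
        refine ⟨M + k, fun _ _ y hy => ?_⟩
        by_contra! hlt
        refine h.not_mem_succ_column (by omega) hk (y := y) (by omega) (by omega) hmem ?_
        rwa [Nat.sub_add_cancel (by omega)]
      · exact ⟨0, fun _ h => absurd h hxc⟩
  choose B hB using bound
  refine ⟨(Finset.range (c + 1)).sup B, fun x y h2 hx hy => ?_⟩
  exact (hB x h2 hx y hy).trans_le (Finset.le_sup (Finset.mem_range.2 (by omega)))

/-- Some column eventually alternates. -/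
theorem exists_alternating_column (h : PlanarUlam U M) :
    ∃ x Y, 2 ≤ x ∧ ∀ y, Y ≤ y → ((x, y + 1) ∈ U ↔ (x, y) ∉ U) := by
  classical
  have hex := h.exists_empty_column
  obtain ⟨hc2, hc⟩ := Nat.find_spec hex
  have hmin : ∀ x, 2 ≤ x → x < Nat.find hex → ∃ y, 2 ≤ y ∧ (x, y) ∈ U := by
    intro x hx hlt
    have := Nat.find_min hex hlt
    push Not at this
    exact this hx
  generalize Nat.find hex = c at hc2 hc hmin
  obtain ⟨B, hB⟩ := h.exists_column_bound hmin
  refine ⟨c + 1, M + 2 * B + 2, by omega, fun y hy => ⟨fun h1 h0 => ?_, fun h0 => h.mem _ ?_⟩⟩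
  · exact h.not_mem_succ_row (by omega) (by omega) le_rfl (by omega) h0 h1
  · refine ⟨(1, y), (c, 1), h.one_mem y, h.mem_one c, by simp only [ne_eq, Prod.mk.injEq]; omega,
      by simp [add_comm], ?_⟩
    have key : ∀ a b : ℕ × ℕ, a ∈ U → b ∈ U → a + b = (c + 1, y + 1) → a.1 ≤ b.1 →
        a = (1, y) ∧ b = (c, 1) := by
      rintro ⟨a1, a2⟩ ⟨b1, b2⟩ ha hb hab hle
      simp only [Prod.mk_add_mk, Prod.mk.injEq] at hab hle
      rcases Nat.lt_or_ge a1 2 with ha2 | ha2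
      · interval_cases a1
        · obtain rfl : a2 = 1 := congrArg Prod.snd ((h.axes _ ha).1 rfl)
          obtain ⟨rfl, rfl⟩ : b1 = c + 1 ∧ b2 = y := by omega
          exact absurd hb h0
        · obtain rfl : b1 = c := by omega
          have hlt : b2 < 2 := by
            by_contra! hlt
            exact hc _ hlt hb
          have hb0 : b2 ≠ 0 := by
            rintro rfl
            have := congrArg Prod.fst ((h.axes _ hb).2 rfl)
            simp only at this
            omega
          obtain rfl : b2 = 1 := by omega
          obtain rfl : a2 = y := by omega
          exact ⟨rfl, rfl⟩
      · have := hB _ _ ha2 (by omega) ha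
        have := hB _ _ (by omega) (by omega) hb
        omega
    intro a b ha hb _ hab
    rcases le_total a.1 b.1 with hle | hle
    · exact Or.inl (key a b ha hb hab hle)
    · exact Or.inr (key b a hb ha (by rw [add_comm, hab]) hle).symm

theorem exists_snd_parity (h : PlanarUlam U M) :
    ∃ X Y p, p < 2 ∧ ∀ u ∈ U, X ≤ u.1 → Y ≤ u.2 → u.2 % 2 = p := by
  classical
  obtain ⟨x, Y, hx, halt⟩ := h.exists_alternating_column
  obtain ⟨p, hp, hpar⟩ : ∃ p < 2, ∀ k, (x, Y + k) ∈ U ↔ (Y + k) % 2 = p := by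
    refine ⟨if (x, Y) ∈ U then Y % 2 else (Y + 1) % 2, by split_ifs <;> omega, fun k => ?_⟩
    induction k with
    | zero =>
      split_ifs with hY
      · simp [hY]
      · simp only [Nat.add_zero, hY, false_iff]
        omega
    | succ k ih =>
      rw [← Nat.add_assoc, halt _ (by omega), ih]
      split_ifs <;> omega
  refine ⟨x, Y + M + 3, p, hp, ?_⟩
  rintro ⟨a, b⟩ hu ha hb
  simp only at ha hb ⊢
  have hn : (x, Y + (b - 1 - Y)) ∉ U := fun hmem =>
    h.not_mem_succ_row (by omega) hx ha (by omega) hmem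
      (by rwa [show Y + (b - 1 - Y) + 1 = b by omega])
  rw [hpar] at hn
  omega

end PlanarUlam

theorem planarUlam_ulamSet2 {n : ℕ} {v : Fin n → ℕ × ℕ}
    (hax : ∀ i, 1 ≤ (v i).1 ∧ 1 ≤ (v i).2) :
    ∃ M, PlanarUlam (ulamSet2 ({(1, 0), (0, 1)} ∪ Set.range v)) M := by
  have hI : AxesTrivial ({(1, 0), (0, 1)} ∪ Set.range v) := by
    rintro u ((rfl | rfl) | ⟨i, rfl⟩)
    · simp
    · simp
    · have := hax i
      constructor <;> intro <;> omega
  have hle : {(1, 0), (0, 1)} ∪ Set.range v ⊆ ulamSet2 ({(1, 0), (0, 1)} ∪ Set.range v) :=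
    Set.subset_iUnion (ulamStage _) 0
  refine ⟨2 + ∑ i, vnorm (v i), hle (by simp), hle (by simp), axesTrivial_ulamSet2 hI,
    fun u hu hM => (mem_or_uniqueRep_of_mem_ulamSet2 hI hu).resolve_left ?_,
    fun u hu => mem_ulamSet2_of_uniqueRep hI hu⟩
  rintro ((rfl | rfl) | ⟨i, rfl⟩)
  · simp only at hM
    omega
  · simp only at hM
    omega
  · have := Finset.single_le_sum (f := fun i => vnorm (v i)) (fun _ _ => Nat.zero_le _)
      (Finset.mem_univ i)
    simp only [vnorm] at this hM
    omega

/-- parity restriction for non-degenerate `(n+2,2)`-Ulam sets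
`𝒰 = U((1,0),(0,1),v₁,…,vₙ)` with no `vᵢ` on a coordinate axis: there is
`(w₁,w₂)` such that every `(m,n') ∈ 𝒰` with `m ≥ w₁`, `n' ≥ w₂` satisfies
`m ≡ w₁` and `n' ≡ w₂ (mod 2)`. -/
theorem stmt19 (n : ℕ) (v : Fin n → ℕ × ℕ)
    (hax : ∀ i, 1 ≤ (v i).1 ∧ 1 ≤ (v i).2)
    (hnd : NonDegenerate ([(1, 0), (0, 1)] ++ List.ofFn v)) :
    ∃ w : ℕ × ℕ, ∀ u ∈ ulamSet2 ({(1, 0), (0, 1)} ∪ Set.range v),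
      w.1 ≤ u.1 → w.2 ≤ u.2 → u.1 % 2 = w.1 % 2 ∧ u.2 % 2 = w.2 % 2 := by
  obtain ⟨M, h⟩ := planarUlam_ulamSet2 hax
  obtain ⟨X, Y, p, hp, hsnd⟩ := h.exists_snd_parity
  obtain ⟨Y', X', q, hq, hfst⟩ := h.swap.exists_snd_parity
  refine ⟨(2 * (X + X') + q, 2 * (Y + Y') + p), fun u hu h1 h2 => ?_⟩
  simp only at h1 h2 ⊢
  have e1 : u.1 % 2 = q := hfst u.swap hu (by simp only [Prod.fst_swap]; omega)
    (by simp only [Prod.snd_swap]; omega)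
  have e2 := hsnd u hu (by omega) (by omega)
  omega
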